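/- For every positive integer w, (7/3)·⌊w/2⌋ ≤ f(w,B) ≤ 3·⌈w/2⌉, where B is the bull graph. -/

import Mathlib

/-!  Common definitions: the online token-coloring game of Milans–Wigal. -/

/-- Tokens `i` and `j` of the play `s` (Spoiler's `i`-th move is at vertex `s i`) are
adjacent in the token graph: they are distinct tokens lying on the same vertex or on
adjacent vertices of `G`. -/
def TokenAdj {V : Type*} (G : SimpleGraph V) (s : ℕ → V) (i j : ℕ) : Prop :=
  i ≠ j ∧ (s i = s j ∨ G.Adj (s i) (s j))

/-- The play consisting of the first `n` tokens of `s` is legal for Spoiler in the game of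
width `w`: the token graph on these `n` tokens has chromatic number at most `w`. -/
def LegalPlay {V : Type*} (G : SimpleGraph V) (w : ℕ) (s : ℕ → V) (n : ℕ) : Prop :=
  ∃ φ : ℕ → ℕ, (∀ i, i < n → φ i < w) ∧
    ∀ i j, i < n → j < n → TokenAdj G s i j → φ i ≠ φ j

/-- The color that Algorithm's (deterministic, online) strategy `σ` assigns to the `i`-th
token of the play `s`: `σ` is applied to the history of Spoiler's moves up to and
including the `i`-th one. -/
def colorOf {V : Type*} (σ : List V → ℕ) (s : ℕ → V) (i : ℕ) : ℕ :=
  σ (List.ofFn fun j : Fin (i + 1) => s j)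

/-- Strategy `σ` for Algorithm wins the token game on `G` of width `w` using at most `k`
colors: against every legal Spoiler play, all assigned colors lie in `{0, …, k-1}` and the
resulting coloring of the token graph is proper. -/
def AlgWins {V : Type*} (G : SimpleGraph V) (w k : ℕ) (σ : List V → ℕ) : Prop :=
  ∀ (n : ℕ) (s : ℕ → V), LegalPlay G w s n →
    (∀ i, i < n → colorOf σ s i < k) ∧
    ∀ i j, i < n → j < n → TokenAdj G s i j → colorOf σ s i ≠ colorOf σ s j

/-- `gameValue G w` is the value `f(w, G)` of the token game on `G` of width `w`: the
minimum number of colors with which Algorithm has a winning strategy. -/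
noncomputable def gameValue {V : Type*} (G : SimpleGraph V) (w : ℕ) : ℕ :=
  sInf {k | ∃ σ : List V → ℕ, AlgWins G w k σ}

/-- The bull graph: a triangle `0,1,2` with pendant vertices `3` (adjacent to `0`) and
`4` (adjacent to `1`). -/
def bullGraph : SimpleGraph (Fin 5) :=
  SimpleGraph.fromRel (fun i j : Fin 5 =>
    (i = 0 ∧ j = 1) ∨ (i = 1 ∧ j = 2) ∨ (i = 0 ∧ j = 2) ∨ (i = 0 ∧ j = 3) ∨ (i = 1 ∧ j = 4))

section LowerBound

/-- The play that places `h` consecutive tokens at each of `v 0`, `v 1`, `v 2`, … -/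
def blockPlay {V : Type*} (h : ℕ) (v : ℕ → V) (i : ℕ) : V := v (i / h)

/-- The set of colors that the coloring `c` uses on the `j`-th block of `h` tokens. -/
def blockColors (c : ℕ → ℕ) (h j : ℕ) : Finset ℕ :=
  (Finset.range h).image fun i => c (h * j + i)

theorem colorOf_congr {V : Type*} (σ : List V → ℕ) {s t : ℕ → V} {i : ℕ}
    (hst : ∀ j ≤ i, s j = t j) : colorOf σ s i = colorOf σ t i := by
  unfold colorOf
  congr 2
  funext j
  exact hst j (Nat.lt_succ_iff.mp j.2)

theorem blockColors_blockPlay_congr {V : Type*} (σ : List V → ℕ) {h j : ℕ} {v v' : ℕ → V}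
    (hv : ∀ l ≤ j, v l = v' l) :
    blockColors (colorOf σ (blockPlay h v)) h j = blockColors (colorOf σ (blockPlay h v')) h j := by
  refine Finset.image_congr fun i hi => colorOf_congr σ fun l hl => hv _ ?_
  have hi : i < h := by simpa using hi
  exact Nat.lt_succ_iff.mp <| (Nat.div_lt_iff_lt_mul (by omega)).mpr
    (by rw [Nat.succ_mul, mul_comm]; omega)

/-- A coloring of the blocks with `m` colors blows up to a coloring of the tokens with `m * h`
colors. -/
theorem legalPlay_blockPlay {V : Type*} {G : SimpleGraph V} {w h m n : ℕ} (hh : 0 < h)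
    (hw : m * h ≤ w) (v : ℕ → V) (e : ℕ → ℕ) (he : ∀ j < n, e j < m)
    (hne : ∀ j < n, ∀ l < n, j ≠ l → (v j = v l ∨ G.Adj (v j) (v l)) → e j ≠ e l) :
    LegalPlay G w (blockPlay h v) (n * h) := by
  have hdiv : ∀ i, (h * e (i / h) + i % h) / h = e (i / h) := fun i => by
    rw [Nat.mul_add_div hh, Nat.div_eq_of_lt (Nat.mod_lt _ hh), add_zero]
  refine ⟨fun i => h * e (i / h) + i % h, fun i hi => ?_, fun i j hi hj hij heq => ?_⟩
  · refine lt_of_lt_of_le ?_ hw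
    rw [← Nat.div_lt_iff_lt_mul hh, hdiv]
    exact he _ ((Nat.div_lt_iff_lt_mul hh).mpr hi)
  · have h1 : e (i / h) = e (j / h) := by
      have := congrArg (· / h) heq
      simpa only [hdiv] using this
    have h2 : i % h = j % h := by
      simp only [h1] at heq
      omega
    by_cases h3 : i / h = j / h
    · exact hij.1 (by rw [← Nat.div_add_mod i h, ← Nat.div_add_mod j h, h2, h3])
    · exact hne _ ((Nat.div_lt_iff_lt_mul hh).mpr hi) _ ((Nat.div_lt_iff_lt_mul hh).mpr hj) h3
        hij.2 h1

/-- Against a winning strategy, a block play uses `h` colors on each block and disjoint sets of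
colors on adjacent blocks. -/
theorem AlgWins.blockColors_spec {V : Type*} {G : SimpleGraph V} {w k h n : ℕ} {σ : List V → ℕ}
    (hσ : AlgWins G w k σ) {v : ℕ → V} (hl : LegalPlay G w (blockPlay h v) (n * h)) :
    (∀ j < n, (blockColors (colorOf σ (blockPlay h v)) h j).card = h) ∧
    (∀ j < n, blockColors (colorOf σ (blockPlay h v)) h j ⊆ Finset.range k) ∧
    ∀ j < n, ∀ l < n, j ≠ l → (v j = v l ∨ G.Adj (v j) (v l)) →
      Disjoint (blockColors (colorOf σ (blockPlay h v)) h j)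
        (blockColors (colorOf σ (blockPlay h v)) h l) := by
  obtain ⟨hk, hp⟩ := hσ _ _ hl
  have hlt : ∀ j < n, ∀ i < h, h * j + i < n * h := fun j hj i hi => by
    nlinarith
  have hv : ∀ j, ∀ i < h, blockPlay h v (h * j + i) = v j := fun j i hi => by
    rw [blockPlay, Nat.mul_add_div (by omega), Nat.div_eq_of_lt hi, add_zero]
  refine ⟨fun j hj => ?_, fun j hj => ?_, fun j hj l hl' hjl hadj => ?_⟩
  · rw [blockColors, Finset.card_image_of_injOn, Finset.card_range]
    intro a ha b hb hab
    by_contra hne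
    have ha : a < h := by simpa using ha
    have hb : b < h := by simpa using hb
    exact hp _ _ (hlt j hj a ha) (hlt j hj b hb)
      ⟨by omega, Or.inl (by rw [hv j a ha, hv j b hb])⟩ hab
  · intro x hx
    obtain ⟨i, hi, rfl⟩ := Finset.mem_image.mp hx
    exact Finset.mem_range.mpr (hk _ (hlt j hj i (Finset.mem_range.mp hi)))
  · rw [Finset.disjoint_left]
    intro x hx hx'
    obtain ⟨a, ha, rfl⟩ := Finset.mem_image.mp hx
    obtain ⟨b, hb, hab⟩ := Finset.mem_image.mp hx'
    rw [Finset.mem_range] at ha hb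
    refine hp _ _ (hlt j hj a ha) (hlt l hl' b hb) ⟨fun heq => hjl ?_, ?_⟩ hab.symm
    · have := congrArg (· / h) heq
      simpa [Nat.mul_add_div (show 0 < h by omega), Nat.div_eq_of_lt ha, Nat.div_eq_of_lt hb]
        using this
    · rwa [hv j a ha, hv l b hb]

/-- The block sequence `3, 4, a, b` in the bull. -/
def bullBlocks (a b : Fin 5) : ℕ → Fin 5
  | 0 => 3
  | 1 => 4
  | 2 => a
  | _ => b

theorem AlgWins.seven_mul_le {w k : ℕ} {σ : List (Fin 5) → ℕ} (hσ : AlgWins bullGraph w k σ) :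
    7 * (w / 2) ≤ 3 * k := by
  set h := w / 2 with hdef
  rcases Nat.eq_zero_or_pos h with h0 | hh
  · omega
  have hw : 2 * h ≤ w := by omega
  have legal : ∀ a b : Fin 5, ∀ e : ℕ → ℕ, (∀ j < 4, e j < 2) →
      (∀ j < 4, ∀ l < 4, j ≠ l →
        (bullBlocks a b j = bullBlocks a b l ∨
          bullGraph.Adj (bullBlocks a b j) (bullBlocks a b l)) → e j ≠ e l) →
      LegalPlay bullGraph w (blockPlay h (bullBlocks a b)) (4 * h) := fun a b e he hne =>
    legalPlay_blockPlay hh hw _ e he hne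
  have l01 := legal 0 1 (fun j => if j = 0 ∨ j = 3 then 0 else 1)
    (by intro j _; split_ifs <;> omega)
    (by intro j hj l hl; interval_cases j <;> interval_cases l <;> simp [bullBlocks, bullGraph])
  have l20 := legal 2 0 (fun j => if j = 0 ∨ j = 2 then 0 else 1)
    (by intro j _; split_ifs <;> omega)
    (by intro j hj l hl; interval_cases j <;> interval_cases l <;> simp [bullBlocks, bullGraph])
  have l21 := legal 2 1 (fun j => if j = 0 ∨ j = 3 then 0 else 1)
    (by intro j _; split_ifs <;> omega)
    (by intro j hj l hl; interval_cases j <;> interval_cases l <;> simp [bullBlocks, bullGraph])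
  obtain ⟨c1, k1, d1⟩ := hσ.blockColors_spec l01
  obtain ⟨c2, k2, d2⟩ := hσ.blockColors_spec l20
  obtain ⟨c3, k3, d3⟩ := hσ.blockColors_spec l21
  have e3 : blockColors (colorOf σ (blockPlay h (bullBlocks 0 1))) h 0 =
      blockColors (colorOf σ (blockPlay h (bullBlocks 2 0))) h 0 :=
    blockColors_blockPlay_congr σ fun l hl => by interval_cases l <;> rfl
  have e4 : blockColors (colorOf σ (blockPlay h (bullBlocks 0 1))) h 1 =
      blockColors (colorOf σ (blockPlay h (bullBlocks 2 1))) h 1 :=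
    blockColors_blockPlay_congr σ fun l hl => by interval_cases l <;> rfl
  have e2 : blockColors (colorOf σ (blockPlay h (bullBlocks 2 0))) h 2 =
      blockColors (colorOf σ (blockPlay h (bullBlocks 2 1))) h 2 :=
    blockColors_blockPlay_congr σ fun l hl => by interval_cases l <;> rfl
  have d03 := d1 0 (by norm_num) 2 (by norm_num) (by norm_num) (by simp [bullBlocks, bullGraph])
  have d14 := d1 1 (by norm_num) 3 (by norm_num) (by norm_num) (by simp [bullBlocks, bullGraph])
  have d01 := d1 2 (by norm_num) 3 (by norm_num) (by norm_num) (by simp [bullBlocks, bullGraph])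
  have d03' := d2 0 (by norm_num) 3 (by norm_num) (by norm_num) (by simp [bullBlocks, bullGraph])
  have d02' := d2 2 (by norm_num) 3 (by norm_num) (by norm_num) (by simp [bullBlocks, bullGraph])
  have d14' := d3 1 (by norm_num) 3 (by norm_num) (by norm_num) (by simp [bullBlocks, bullGraph])
  have d12' := d3 2 (by norm_num) 3 (by norm_num) (by norm_num) (by simp [bullBlocks, bullGraph])
  have c3₁ := c1 0 (by norm_num)
  have c4₁ := c1 1 (by norm_num)
  have c0₁ := c1 2 (by norm_num)
  have c1₁ := c1 3 (by norm_num)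
  have k3₁ := k1 0 (by norm_num)
  have k0₁ := k1 2 (by norm_num)
  have k1₁ := k1 3 (by norm_num)
  have k4₁ := k1 1 (by norm_num)
  have c2₂ := c2 2 (by norm_num)
  have c0₂ := c2 3 (by norm_num)
  have k2₂ := k2 2 (by norm_num)
  have k0₂ := k2 3 (by norm_num)
  have c1₃ := c3 3 (by norm_num)
  have k1₃ := k3 3 (by norm_num)
  rw [← e3] at d03'
  rw [← e4] at d14'
  rw [← e2] at d12'
  clear c1 c2 c3 k1 k2 k3 d1 d2 d3 e3 e4 e2 l01 l20 l21 legal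
  generalize blockColors (colorOf σ (blockPlay h (bullBlocks 0 1))) h 0 = S3 at *
  generalize blockColors (colorOf σ (blockPlay h (bullBlocks 0 1))) h 1 = S4 at *
  generalize blockColors (colorOf σ (blockPlay h (bullBlocks 0 1))) h 2 = T0 at *
  generalize blockColors (colorOf σ (blockPlay h (bullBlocks 0 1))) h 3 = T1 at *
  generalize blockColors (colorOf σ (blockPlay h (bullBlocks 2 0))) h 2 = S2 at *
  generalize blockColors (colorOf σ (blockPlay h (bullBlocks 2 0))) h 3 = T0' at *
  generalize blockColors (colorOf σ (blockPlay h (bullBlocks 2 1))) h 3 = T1' at *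
  have b1 : (S3 ∩ S4).card + h + h ≤ k := by
    have hd : Disjoint (S3 ∩ S4) T0 := d03.mono_left Finset.inter_subset_left
    have hd' : Disjoint (S3 ∩ S4 ∪ T0) T1 :=
      Finset.disjoint_union_left.mpr ⟨d14.mono_left Finset.inter_subset_right, d01⟩
    have := Finset.card_le_card (Finset.union_subset (Finset.union_subset
      (Finset.inter_subset_left.trans k3₁ : S3 ∩ S4 ⊆ _) k0₁) k1₁)
    rwa [Finset.card_union_of_disjoint hd', Finset.card_union_of_disjoint hd, c0₁, c1₁,
      Finset.card_range] at this
  have b2 : (S2 ∪ S3).card + h ≤ k := by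
    have hd : Disjoint (S2 ∪ S3) T0' := Finset.disjoint_union_left.mpr ⟨d02', d03'⟩
    have := Finset.card_le_card (Finset.union_subset (Finset.union_subset k2₂ k3₁) k0₂)
    rwa [Finset.card_union_of_disjoint hd, c0₂, Finset.card_range] at this
  have b3 : (S2 ∪ S4).card + h ≤ k := by
    have hd : Disjoint (S2 ∪ S4) T1' := Finset.disjoint_union_left.mpr ⟨d12', d14'⟩
    have := Finset.card_le_card (Finset.union_subset (Finset.union_subset k2₂ k4₁) k1₃)
    rwa [Finset.card_union_of_disjoint hd, c1₃, Finset.card_range] at this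
  have u1 := Finset.card_union_add_card_inter (S2 ∪ S3) (S2 ∪ S4)
  have u2 := Finset.card_union_add_card_inter S3 S4
  have m1 : (S3 ∪ S4).card ≤ ((S2 ∪ S3) ∪ (S2 ∪ S4)).card :=
    Finset.card_le_card
      (Finset.union_subset_union Finset.subset_union_right Finset.subset_union_right)
  have m2 : S2.card ≤ ((S2 ∪ S3) ∩ (S2 ∪ S4)).card :=
    Finset.card_le_card
      (Finset.subset_inter Finset.subset_union_left Finset.subset_union_left)
  omega

end LowerBound

section UpperBound

/-- Every rule that picks a color from the vertex of the new token and the sets of colors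
already used at the vertices is realized by a strategy. -/
theorem exists_strategy_of_rule {V : Type*} (F : (V → Set ℕ) → V → ℕ) :
    ∃ σ : List V → ℕ, ∀ (s : ℕ → V) (i : ℕ),
      colorOf σ s i = F (fun v => {x | ∃ j < i, s j = v ∧ colorOf σ s j = x}) (s i) := by
  let step : (V → Set ℕ) → V → V → Set ℕ := fun st u v => {x | x ∈ st v ∨ u = v ∧ F st u = x}
  let state : List V → V → Set ℕ := fun l => l.foldl step fun _ => ∅
  let σ : List V → ℕ := fun l =>
    match l.getLast? with
    | none => 0
    | some v => F (state l.dropLast) v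
  have hofFn : ∀ (s : ℕ → V) (n : ℕ), (List.ofFn fun j : Fin (n + 1) => s j) =
      (List.ofFn fun j : Fin n => s j) ++ [s n] := fun s n => by
    rw [List.ofFn_succ', List.concat_eq_append]
    rfl
  have hσ : ∀ (s : ℕ → V) (i : ℕ),
      colorOf σ s i = F (state (List.ofFn fun j : Fin i => s j)) (s i) := fun s i => by
    simp only [colorOf, hofFn, σ, List.getLast?_concat, List.dropLast_concat]
  have hstate : ∀ (s : ℕ → V) (i : ℕ), state (List.ofFn fun j : Fin i => s j) =
      fun v => {x | ∃ j < i, s j = v ∧ colorOf σ s j = x} := by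
    intro s i
    induction i with
    | zero => funext v; simp [state]
    | succ i ih =>
      have : state (List.ofFn fun j : Fin (i + 1) => s j) =
          step (state (List.ofFn fun j : Fin i => s j)) (s i) := by
        simp only [state, hofFn, List.foldl_append, List.foldl_cons, List.foldl_nil]
      rw [this]
      funext v
      ext x
      change (x ∈ state _ v ∨ s i = v ∧ F (state _) (s i) = x) ↔ _
      rw [← hσ, ih]
      simp only [Set.mem_ofPred_eq, Nat.lt_succ_iff_lt_or_eq, or_and_right, exists_or,
        exists_eq_left]
  exact ⟨σ, fun s i => by rw [hσ, hstate]⟩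

/-- Equal or adjacent vertices: tokens at them receive different colors. -/
def Near {V : Type*} (G : SimpleGraph V) (u v : V) : Prop := u = v ∨ G.Adj u v

/-- The strategy that gives a new token at `v` a free color of `P v`, or of `Q v` if there is no
such color. Its last alternative is that both sets are exhausted. -/
theorem exists_preference_strategy {V : Type*} (G : SimpleGraph V) (P Q : V → Finset ℕ) :
    ∃ σ : List V → ℕ, ∀ (s : ℕ → V) (i : ℕ),
      ((colorOf σ s i ∈ P (s i) ∨ colorOf σ s i ∈ Q (s i) ∧
          ∀ x ∈ P (s i), ∃ j < i, Near G (s j) (s i) ∧ colorOf σ s j = x) ∧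
        ∀ j < i, Near G (s j) (s i) → colorOf σ s j ≠ colorOf σ s i) ∨
      ∀ x ∈ P (s i) ∪ Q (s i), ∃ j < i, Near G (s j) (s i) ∧ colorOf σ s j = x := by
  classical
  let free : (V → Set ℕ) → V → Set ℕ := fun st v => {x | ∀ u, Near G u v → x ∉ st u}
  obtain ⟨σ, hσ⟩ := exists_strategy_of_rule fun st v =>
    if (↑(P v) ∩ free st v).Nonempty then sInf (↑(P v) ∩ free st v)
    else sInf (↑(Q v) ∩ free st v)
  refine ⟨σ, fun s i => ?_⟩
  set st : V → Set ℕ := fun v => {x | ∃ j < i, s j = v ∧ colorOf σ s j = x} with hst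
  have hfree : ∀ x, x ∈ free st (s i) ↔
      ¬ ∃ j < i, Near G (s j) (s i) ∧ colorOf σ s j = x := by
    intro x
    simp only [free, hst, Set.mem_ofPred_eq]
    constructor
    · rintro h ⟨j, hj, hn, hx⟩
      exact h _ hn ⟨j, hj, rfl, hx⟩
    · rintro h _ hn ⟨j, hj, rfl, hx⟩
      exact h ⟨j, hj, hn, hx⟩
  have hi := hσ s i
  have hproper : colorOf σ s i ∈ free st (s i) →
      ∀ j < i, Near G (s j) (s i) → colorOf σ s j ≠ colorOf σ s i :=
    fun h j hj hn he => (hfree _).mp h ⟨j, hj, hn, he⟩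
  by_cases hP : (↑(P (s i)) ∩ free st (s i)).Nonempty
  · rw [if_pos hP] at hi
    have := Nat.sInf_mem hP
    rw [← hi] at this
    exact Or.inl ⟨Or.inl this.1, hproper this.2⟩
  rw [if_neg hP] at hi
  have hPused : ∀ x ∈ P (s i), ∃ j < i, Near G (s j) (s i) ∧ colorOf σ s j = x := by
    intro x hx
    by_contra hc
    exact hP ⟨x, hx, (hfree x).mpr hc⟩
  by_cases hQ : (↑(Q (s i)) ∩ free st (s i)).Nonempty
  · have := Nat.sInf_mem hQ
    rw [← hi] at this
    exact Or.inl ⟨Or.inr ⟨this.1, hPused⟩, hproper this.2⟩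
  · refine Or.inr fun x hx => ?_
    rcases Finset.mem_union.mp hx with hx | hx
    · exact hPused x hx
    · by_contra hc
      exact hQ ⟨x, hx, (hfree x).mpr hc⟩

/-- Before the last token of a legal play is placed in a clique `K`, fewer than `w` colors are
used on `K`. -/
theorem LegalPlay.card_lt_of_clique {V : Type*} {G : SimpleGraph V} {w n : ℕ} {s : ℕ → V}
    (hl : LegalPlay G w s (n + 1)) {K : Set V} (hK : ∀ u ∈ K, ∀ v ∈ K, Near G u v)
    (hn : s n ∈ K) {c : ℕ → ℕ} {X : Finset ℕ}
    (hX : ∀ x ∈ X, ∃ u ∈ K, ∃ j < n, s j = u ∧ c j = x) : X.card < w := by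
  obtain ⟨φ, hφ, hp⟩ := hl
  choose! g hgK f hf hs hc using hX
  have hmem : ∀ x ∈ X, s (f x) ∈ K := fun x hx => by rw [hs x hx]; exact hgK x hx
  have hsub : X.image (fun x => φ (f x)) ⊆ (Finset.range w).erase (φ n) := by
    intro y hy
    obtain ⟨x, hx, rfl⟩ := Finset.mem_image.mp hy
    have := hf x hx
    exact Finset.mem_erase.mpr
      ⟨hp _ _ (by omega) (by omega) ⟨this.ne, hK _ (hmem x hx) _ hn⟩,
        Finset.mem_range.mpr (hφ _ (by omega))⟩
  have hcard := Finset.card_le_card hsub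
  have hw := hφ n (by omega)
  rw [Finset.card_erase_of_mem (Finset.mem_range.mpr hw), Finset.card_range,
    Finset.card_image_of_injOn] at hcard
  · omega
  · intro x hx y hy hxy
    by_contra hne
    have h1 := hf x hx
    have h2 := hf y hy
    refine hp _ _ (by omega) (by omega) ⟨fun h => hne ?_, hK _ (hmem x hx) _ (hmem y hy)⟩ hxy
    rw [← hc x hx, ← hc y hy, h]

/-- First preferences of the vertices of the bull among three color classes. -/
def bullFirst (A B C : Finset ℕ) : Fin 5 → Finset ℕ := ![A, B, C, B, A]

/-- Second preferences of the vertices of the bull among three color classes. -/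
def bullSecond (A C : Finset ℕ) : Fin 5 → Finset ℕ := ![C, C, A, C, C]

theorem exists_near_bull (p : Fin 5 → Prop) :
    ((∃ u, Near bullGraph u 0 ∧ p u) ↔ p 0 ∨ p 1 ∨ p 2 ∨ p 3) ∧
    ((∃ u, Near bullGraph u 1 ∧ p u) ↔ p 0 ∨ p 1 ∨ p 2 ∨ p 4) ∧
    ((∃ u, Near bullGraph u 2 ∧ p u) ↔ p 0 ∨ p 1 ∨ p 2) ∧
    ((∃ u, Near bullGraph u 3 ∧ p u) ↔ p 0 ∨ p 3) ∧
    ((∃ u, Near bullGraph u 4 ∧ p u) ↔ p 1 ∨ p 4) := by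
  refine ⟨?_, ?_, ?_, ?_, ?_⟩ <;> simp [Near, bullGraph, Fin.exists_fin_succ] <;> tauto

/-- If every color in use respects the preferences and the cliques at `v` are not full, then `v`
has a free color. -/
theorem bull_not_exhausted {h : ℕ} {A B C : Finset ℕ} (hA : A.card = h) (hB : B.card = h)
    (hC : C.card = h) (hAB : Disjoint A B) (hAC : Disjoint A C) (hBC : Disjoint B C)
    {used : Fin 5 → ℕ → Prop} {v : Fin 5}
    (hpref : ∀ u x, used u x → x ∈ bullFirst A B C u ∨ x ∈ bullSecond A C u ∧
      ∀ y ∈ bullFirst A B C u, ∃ u', Near bullGraph u' u ∧ used u' y)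
    (hclique : ∀ K : Set (Fin 5), (∀ a ∈ K, ∀ b ∈ K, Near bullGraph a b) → v ∈ K →
      ∀ X : Finset ℕ, (∀ x ∈ X, ∃ u ∈ K, used u x) → X.card < 2 * h) :
    ¬ ∀ x ∈ bullFirst A B C v ∪ bullSecond A C v, ∃ u, Near bullGraph u v ∧ used u x := by
  have cAB : (A ∪ B).card = 2 * h := by rw [Finset.card_union_of_disjoint hAB]; omega
  have cAC : (A ∪ C).card = 2 * h := by rw [Finset.card_union_of_disjoint hAC]; omega
  have cBC : (B ∪ C).card = 2 * h := by rw [Finset.card_union_of_disjoint hBC]; omega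
  rw [Finset.disjoint_left] at hAB hAC hBC
  have triangle : ∀ X : Finset ℕ, X.card = 2 * h → (v = 0 ∨ v = 1 ∨ v = 2) →
      ¬ ∀ x ∈ X, used 0 x ∨ used 1 x ∨ used 2 x := fun X hX hv hu => by
    refine absurd (hclique {0, 1, 2} ?_ (by simpa using hv) X (by simpa using hu)) (by omega)
    rintro a (rfl | rfl | rfl) b (rfl | rfl | rfl) <;> simp [Near, bullGraph]
  have edge03 : ∀ X : Finset ℕ, X.card = 2 * h → (v = 0 ∨ v = 3) →
      ¬ ∀ x ∈ X, used 0 x ∨ used 3 x := fun X hX hv hu => by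
    refine absurd (hclique {0, 3} ?_ (by simpa using hv) X (by simpa using hu)) (by omega)
    rintro a (rfl | rfl) b (rfl | rfl) <;> simp [Near, bullGraph]
  have edge14 : ∀ X : Finset ℕ, X.card = 2 * h → (v = 1 ∨ v = 4) →
      ¬ ∀ x ∈ X, used 1 x ∨ used 4 x := fun X hX hv hu => by
    refine absurd (hclique {1, 4} ?_ (by simpa using hv) X (by simpa using hu)) (by omega)
    rintro a (rfl | rfl) b (rfl | rfl) <;> simp [Near, bullGraph]
  have p0 := hpref 0
  have p1 := hpref 1
  have p2 := hpref 2
  have p3 := hpref 3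
  have p4 := hpref 4
  have n0 := fun x => (exists_near_bull fun u => used u x).1
  have n1 := fun x => (exists_near_bull fun u => used u x).2.1
  have n2 := fun x => (exists_near_bull fun u => used u x).2.2.1
  have n3 := fun x => (exists_near_bull fun u => used u x).2.2.2.1
  have n4 := fun x => (exists_near_bull fun u => used u x).2.2.2.2
  clear hpref hclique hA hB hC
  simp only [bullFirst, bullSecond, n0, n1, n2, n3, n4, Matrix.cons_val] at p0 p1 p2 p3 p4
  intro hex
  have first3 : ∀ x, used 3 x → x ∈ C → ∀ y ∈ B, used 3 y := by
    grind
  have first4 : ∀ x, used 4 x → x ∈ C → ∀ y ∈ A, used 4 y := by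
    grind
  have first2 : ∀ x, used 2 x → x ∈ A → ∀ y ∈ C, used 0 y ∨ used 1 y ∨ used 2 y := by
    grind
  fin_cases v
  · simp only [bullFirst, bullSecond, Fin.zero_eta, Matrix.cons_val, n0] at hex
    refine triangle (A ∪ C) cAC (by simp) ?_
    by_contra! hc
    obtain ⟨x, hx, hx0, hx1, hx2⟩ := hc
    have hx3 : used 3 x := by grind
    have hB3 := first3 x hx3 (by grind)
    refine edge03 (A ∪ B) cAB (by simp) ?_
    by_contra! hc
    obtain ⟨y, hy, hy0, hy3⟩ := hc
    have hyA : y ∈ A := by grind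
    have hC2 := first2 y (by grind) hyA
    grind
  · simp only [bullFirst, bullSecond, Fin.mk_one, Matrix.cons_val, n1] at hex
    have hB1 : ∀ y ∈ B, used 1 y := by grind
    refine triangle (B ∪ C) cBC (by simp) ?_
    by_contra! hc
    obtain ⟨x, hx, hx0, hx1, hx2⟩ := hc
    have hA4 := first4 x (by grind) (by grind)
    exact edge14 (A ∪ B) cAB (by simp) (by grind)
  · simp only [bullFirst, bullSecond, Fin.reduceFinMk, Matrix.cons_val, n2] at hex
    exact triangle (C ∪ A) (by rwa [Finset.union_comm]) (by simp) hex
  · simp only [bullFirst, bullSecond, Fin.reduceFinMk, Matrix.cons_val, n3] at hex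
    exact edge03 (B ∪ C) cBC (by simp) hex
  · simp only [bullFirst, bullSecond, Fin.reduceFinMk, Matrix.cons_val, n4] at hex
    exact edge14 (A ∪ C) cAC (by simp) hex

theorem exists_algWins_bull {w h : ℕ} (hw : w ≤ 2 * h) :
    ∃ σ, AlgWins bullGraph w (3 * h) σ := by
  set A := Finset.Ico 0 h with hA
  set B := Finset.Ico h (2 * h) with hB
  set C := Finset.Ico (2 * h) (3 * h) with hC
  obtain ⟨σ, hσ⟩ := exists_preference_strategy bullGraph (bullFirst A B C) (bullSecond A C)
  refine ⟨σ, fun n s hl => ?_⟩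
  have legal : ∀ i < n, LegalPlay bullGraph w s (i + 1) := fun i hi => by
    obtain ⟨φ, h1, h2⟩ := hl
    exact ⟨φ, fun j hj => h1 j (by omega), fun j l hj hl => h2 j l (by omega) (by omega)⟩
  have key : ∀ i < n,
      (colorOf σ s i ∈ bullFirst A B C (s i) ∨ colorOf σ s i ∈ bullSecond A C (s i) ∧
        ∀ x ∈ bullFirst A B C (s i), ∃ j < i, Near bullGraph (s j) (s i) ∧ colorOf σ s j = x) ∧
      ∀ j < i, Near bullGraph (s j) (s i) → colorOf σ s j ≠ colorOf σ s i := by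
    intro i
    induction i using Nat.strong_induction_on with
    | _ i ih =>
    intro hi
    refine (hσ s i).resolve_right fun hex => ?_
    refine bull_not_exhausted (h := h) (A := A) (B := B) (C := C) (v := s i)
      (used := fun u x => ∃ j < i, s j = u ∧ colorOf σ s j = x) (by simp [hA])
      (by simp [hB]; omega) (by simp [hC]; omega) ?_ ?_ ?_ ?_ ?_ ?_
    · rw [Finset.disjoint_left]; intro x; simp [hA, hB]; omega
    · rw [Finset.disjoint_left]; intro x; simp [hA, hC]; omega
    · rw [Finset.disjoint_left]; intro x; simp [hB, hC]; omega
    · rintro _ _ ⟨j, hj, rfl, rfl⟩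
      refine (ih j hj (by omega)).1.imp_right fun ⟨h1, h2⟩ => ⟨h1, fun y hy => ?_⟩
      obtain ⟨l, hl, hn, hx⟩ := h2 y hy
      exact ⟨s l, hn, l, by omega, rfl, hx⟩
    · intro K hK hv X hX
      exact ((legal i hi).card_lt_of_clique hK hv hX).trans_le hw
    · intro x hx
      obtain ⟨j, hj, hn, hx⟩ := hex x hx
      exact ⟨s j, hn, j, hj, rfl, hx⟩
  refine ⟨fun i hi => ?_, fun i j hi hj hij => ?_⟩
  · have hlt : ∀ u, ∀ x ∈ bullFirst A B C u ∪ bullSecond A C u, x < 3 * h := by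
      intro u x
      fin_cases u <;> simp [bullFirst, bullSecond, hA, hB, hC] <;> omega
    exact hlt (s i) _ (Finset.mem_union.mpr ((key i hi).1.imp_right And.left))
  · rcases lt_or_gt_of_ne hij.1 with hlt | hlt
    · exact (key j hj).2 i hlt hij.2
    · exact ((key i hi).2 j hlt (hij.2.imp Eq.symm SimpleGraph.Adj.symm)).symm

end UpperBound

/-- For every positive integer `w`, `(7/3)·⌊w/2⌋ ≤ f(w, B) ≤ 3·⌈w/2⌉`, where `B` is the
bull graph. -/
theorem gameValue_bull (w : ℕ) (hw : 0 < w) :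
    (7 / 3 : ℚ) * ((w / 2 : ℕ) : ℚ) ≤ (gameValue bullGraph w : ℚ) ∧
      (gameValue bullGraph w : ℚ) ≤ 3 * (⌈(w : ℚ) / 2⌉ : ℚ) := by
  have hwin : 3 * ((w + 1) / 2) ∈ {k | ∃ σ : List (Fin 5) → ℕ, AlgWins bullGraph w k σ} :=
    exists_algWins_bull (by omega)
  constructor
  · obtain ⟨σ, hσ⟩ := Nat.sInf_mem ⟨_, hwin⟩
    have h := hσ.seven_mul_le
    change 7 * (w / 2) ≤ 3 * gameValue bullGraph w at h
    have h' : (7 : ℚ) * ((w / 2 : ℕ) : ℚ) ≤ 3 * (gameValue bullGraph w : ℚ) := by exact_mod_cast h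
    linarith
  · have h1 : gameValue bullGraph w ≤ 3 * ((w + 1) / 2) := Nat.sInf_le hwin
    have h2 : ((((w + 1) / 2 : ℕ) : ℤ) - 1) < ⌈(w : ℚ) / 2⌉ := by
      rw [Int.lt_ceil]
      have h3 : 2 * ((w + 1) / 2) < w + 2 := by omega
      have h4 : (2 : ℚ) * (((w + 1) / 2 : ℕ) : ℚ) < w + 2 := by exact_mod_cast h3
      rw [Int.cast_sub, Int.cast_natCast, Int.cast_one]
      linarith
    have h5 : (gameValue bullGraph w : ℤ) ≤ 3 * ⌈(w : ℚ) / 2⌉ := by omega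
    exact_mod_cast h5
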